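/- Let ≺ ∈ WOEP_m and ⋖ ∈ WOEP_n be total orders. Then underprod(≺,⋖) and overprod(≺,⋖) are total orders, and (≺ ⧢ ⋖) ∩ WOEP_{m+n} = {⊣ ∈ WOEP_{m+n} : underprod(≺,⋖) ≼ ⊣ ≼ overprod(≺,⋖)}, where ≼ is the weak order. -/

import Mathlib

namespace IntegerRelations

/-- An integer relation of size `p` is a reflexive binary relation on `Fin p`,
encoded as a set of pairs; `IsIRel R` says that `R` is reflexive. -/
def IsIRel {p : ℕ} (R : Set (Fin p × Fin p)) : Prop :=
  ∀ i : Fin p, (i, i) ∈ R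

/-- The increasing subrelation `Inc R`. -/
def inc {p : ℕ} (R : Set (Fin p × Fin p)) : Set (Fin p × Fin p) :=
  {x ∈ R | x.1 < x.2}

/-- The decreasing subrelation `Dec R`. -/
def dec {p : ℕ} (R : Set (Fin p × Fin p)) : Set (Fin p × Fin p) :=
  {x ∈ R | x.2 < x.1}

/-- The weak order: `R ≼ S` iff `Inc R ⊇ Inc S` and `Dec R ⊆ Dec S`. -/
def WOle {p : ℕ} (R S : Set (Fin p × Fin p)) : Prop :=
  inc S ⊆ inc R ∧ dec R ⊆ dec S

/-- Standardized restriction of a relation to a subset `X` of cardinality `k`. -/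
def restrict {p k : ℕ} (R : Set (Fin p × Fin p)) (X : Finset (Fin p))
    (h : X.card = k) : Set (Fin k × Fin k) :=
  {x | ((X.orderIsoOfFin h x.1 : Fin p), (X.orderIsoOfFin h x.2 : Fin p)) ∈ R}

/-- Standardized restriction of a relation to the block of `k` consecutive
positions starting at offset `o` (`0`-indexed). -/
def restrictRange {p : ℕ} (R : Set (Fin p × Fin p)) (o k : ℕ) :
    Set (Fin k × Fin k) :=
  {x | ∃ (h₁ : o + (x.1 : ℕ) < p) (h₂ : o + (x.2 : ℕ) < p),
      ((⟨o + (x.1 : ℕ), h₁⟩ : Fin p), (⟨o + (x.2 : ℕ), h₂⟩ : Fin p)) ∈ R}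

/-- The relation `R` placed on the first `m` values of `[m+n]`. -/
def shiftL {m n : ℕ} (R : Set (Fin m × Fin m)) :
    Set (Fin (m + n) × Fin (m + n)) :=
  {x | ∃ y ∈ R, x = (Fin.castAdd n y.1, Fin.castAdd n y.2)}

/-- The relation `S` shifted to the last `n` values of `[m+n]`. -/
def shiftR {m n : ℕ} (S : Set (Fin n × Fin n)) :
    Set (Fin (m + n) × Fin (m + n)) :=
  {x | ∃ y ∈ S, x = (Fin.natAdd m y.1, Fin.natAdd m y.2)}

/-- The full block `[m] × [n̄]`. -/
def lowHigh (m n : ℕ) : Set (Fin (m + n) × Fin (m + n)) :=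
  {x | (x.1 : ℕ) < m ∧ m ≤ (x.2 : ℕ)}

/-- The full block `[n̄] × [m]`. -/
def highLow (m n : ℕ) : Set (Fin (m + n) × Fin (m + n)) :=
  {x | m ≤ (x.1 : ℕ) ∧ (x.2 : ℕ) < m}

/-- The shifted shuffle `R ⧢ S` of two integer relations. -/
def shiftedShuffle {m n : ℕ} (R : Set (Fin m × Fin m)) (S : Set (Fin n × Fin n)) :
    Set (Set (Fin (m + n) × Fin (m + n))) :=
  {T | ∃ I D : Set (Fin (m + n) × Fin (m + n)),
      I ⊆ lowHigh m n ∧ D ⊆ highLow m n ∧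
      T = shiftL R ∪ shiftR S ∪ I ∪ D}

/-- `underprod R S = R ∪ S̄ ∪ ([m] × [n̄])`. -/
def underprod {m n : ℕ} (R : Set (Fin m × Fin m)) (S : Set (Fin n × Fin n)) :
    Set (Fin (m + n) × Fin (m + n)) :=
  shiftL R ∪ shiftR S ∪ lowHigh m n

/-- `overprod R S = R ∪ S̄ ∪ ([n̄] × [m])`. -/
def overprod {m n : ℕ} (R : Set (Fin m × Fin m)) (S : Set (Fin n × Fin n)) :
    Set (Fin (m + n) × Fin (m + n)) :=
  shiftL R ∪ shiftR S ∪ highLow m n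

/-- A total cut `(X, Y)` of a relation `T`. -/
def IsTotalCut {p : ℕ} (T : Set (Fin p × Fin p)) (X Y : Finset (Fin p)) : Prop :=
  (∀ i : Fin p, i ∈ X ∨ i ∈ Y) ∧ Disjoint X Y ∧
    ∀ x ∈ X, ∀ y ∈ Y, (x, y) ∈ T ∧ (y, x) ∉ T

/-- The convolution `R ∗ S` of two integer relations. -/
def convolution {m n : ℕ} (R : Set (Fin m × Fin m)) (S : Set (Fin n × Fin n)) :
    Set (Set (Fin (m + n) × Fin (m + n))) :=
  {T | ∃ (X Y : Finset (Fin (m + n))) (hX : X.card = m) (hY : Y.card = n),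
      IsTotalCut T X Y ∧ restrict T X hX = R ∧ restrict T Y hY = S}

/-- An integer poset: a reflexive, antisymmetric and transitive integer relation. -/
def IsIPos {p : ℕ} (T : Set (Fin p × Fin p)) : Prop :=
  IsIRel T ∧ (∀ a b : Fin p, (a, b) ∈ T → (b, a) ∈ T → a = b) ∧
    ∀ a b c : Fin p, (a, b) ∈ T → (b, c) ∈ T → (a, c) ∈ T

/-- A total order: an integer poset in which any two elements are comparable
(these are exactly the weak order element posets, `WOEP`). -/
def IsITotal {p : ℕ} (T : Set (Fin p × Fin p)) : Prop :=
  IsIPos T ∧ ∀ a b : Fin p, (a, b) ∈ T ∨ (b, a) ∈ T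

/-- `T` admits a primitive cut at `k` (here positions are `0`-indexed, so the
`1`-indexed condition `i ≤ k < j` reads `i < k ≤ j`). -/
def HasPrimitiveCutAt {p : ℕ} (T : Set (Fin p × Fin p)) (k : ℕ) : Prop :=
  ∀ i j : Fin p, (i : ℕ) < k → k ≤ (j : ℕ) → (i, j) ∈ T ∧ (j, i) ∉ T

/-- `T` is under-indecomposable: no non-trivial primitive cut. -/
def UnderIndecomposable {p : ℕ} (T : Set (Fin p × Fin p)) : Prop :=
  ∀ k : ℕ, 0 < k → k < p → ¬ HasPrimitiveCutAt T k

/-- Membership in `IWOIP`. -/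
def InIWOIP {p : ℕ} (T : Set (Fin p × Fin p)) : Prop :=
  IsIPos T ∧ ∀ a b c : Fin p, a < b → b < c → (a, c) ∈ T → (a, b) ∈ T ∨ (b, c) ∈ T

/-- Membership in `DWOIP`. -/
def InDWOIP {p : ℕ} (T : Set (Fin p × Fin p)) : Prop :=
  IsIPos T ∧ ∀ a b c : Fin p, a < b → b < c → (c, a) ∈ T → (b, a) ∈ T ∨ (c, b) ∈ T

/-- Membership in `WOIP = IWOIP ∩ DWOIP`. -/
def InWOIP {p : ℕ} (T : Set (Fin p × Fin p)) : Prop := InIWOIP T ∧ InDWOIP T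

/-- Membership in `WOFP`. -/
def InWOFP {p : ℕ} (T : Set (Fin p × Fin p)) : Prop :=
  InWOIP T ∧ ∀ a b c : Fin p, a < b → b < c → (a, c) ∉ T → (c, a) ∉ T →
    (((a, b) ∈ T ↔ (c, b) ∈ T) ∧ ((b, a) ∈ T ↔ (b, c) ∈ T))

/-- The `IWOIP` increasing deletion. -/
def IWOIPid {p : ℕ} (T : Set (Fin p × Fin p)) : Set (Fin p × Fin p) :=
  T \ {x | x.1 < x.2 ∧ ∃ l : List (Fin p), l ≠ [] ∧
      List.Chain (fun a b : Fin p => a < b ∧ (a, b) ∉ T) x.1 (l ++ [x.2])}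

/-- The `DWOIP` decreasing deletion. -/
def DWOIPdd {p : ℕ} (T : Set (Fin p × Fin p)) : Set (Fin p × Fin p) :=
  T \ {x | x.2 < x.1 ∧ ∃ l : List (Fin p), l ≠ [] ∧
      List.Chain (fun a b : Fin p => a < b ∧ (b, a) ∉ T) x.2 (l ++ [x.1])}

/-- The `WOIP` deletion. -/
def WOIPd {p : ℕ} (T : Set (Fin p × Fin p)) : Set (Fin p × Fin p) :=
  IWOIPid (DWOIPdd T)

/-- The chain poset `≺_σ` of a permutation: `u ≺_σ v` iff `σ⁻¹ u ≤ σ⁻¹ v`. -/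
def chainPoset {p : ℕ} (σ : Equiv.Perm (Fin p)) : Set (Fin p × Fin p) :=
  {x | σ.symm x.1 ≤ σ.symm x.2}

/-- The shifted shuffle of two permutations. -/
def permShiftedShuffle {m n : ℕ} (σ : Equiv.Perm (Fin m)) (τ : Equiv.Perm (Fin n)) :
    Set (Equiv.Perm (Fin (m + n))) :=
  {ρ | (∀ u v : Fin m,
        ρ.symm (Fin.castAdd n u) < ρ.symm (Fin.castAdd n v) ↔ σ.symm u < σ.symm v) ∧
      ∀ u v : Fin n,
        ρ.symm (Fin.natAdd m u) < ρ.symm (Fin.natAdd m v) ↔ τ.symm u < τ.symm v}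

/-- The convolution of two permutations. -/
def permConvolution {m n : ℕ} (σ : Equiv.Perm (Fin m)) (τ : Equiv.Perm (Fin n)) :
    Set (Equiv.Perm (Fin (m + n))) :=
  {ρ | (∀ i j : Fin m, ρ (Fin.castAdd n i) < ρ (Fin.castAdd n j) ↔ σ i < σ j) ∧
      ∀ i j : Fin n, ρ (Fin.natAdd m i) < ρ (Fin.natAdd m j) ↔ τ i < τ j}

/-- Relabelling of a relation along a bijection. -/
def relabel {p q : ℕ} (e : Fin p ≃ Fin q) (T : Set (Fin p × Fin p)) :
    Set (Fin q × Fin q) :=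
  {x | (e.symm x.1, e.symm x.2) ∈ T}

/-- The diagonal `Δ_p`. -/
def diagonal (p : ℕ) : Set (Fin p × Fin p) := {x | x.1 = x.2}

section helpers
variable {m n : ℕ} (P : Set (Fin m × Fin m)) (Q : Set (Fin n × Fin n))

theorem shiftL_ll (a b : Fin m) :
    ((Fin.castAdd n a, Fin.castAdd n b) ∈ shiftL (n := n) P) ↔ (a, b) ∈ P := by
  constructor
  · rintro ⟨⟨c, d⟩, h, e⟩
    simp only [Prod.mk.injEq, Fin.castAdd_inj] at e
    rw [e.1, e.2]; exact h
  · intro h; exact ⟨(a, b), h, rfl⟩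

theorem shiftR_rr (a b : Fin n) :
    ((Fin.natAdd m a, Fin.natAdd m b) ∈ shiftR (m := m) Q) ↔ (a, b) ∈ Q := by
  constructor
  · rintro ⟨⟨c, d⟩, h, e⟩
    simp only [Prod.mk.injEq, Fin.natAdd_inj] at e
    rw [e.1, e.2]; exact h
  · intro h; exact ⟨(a, b), h, rfl⟩

theorem shiftL_bound {x y : Fin (m + n)} (h : (x, y) ∈ shiftL (n := n) P) :
    (x : ℕ) < m ∧ (y : ℕ) < m := by
  obtain ⟨⟨c, d⟩, _, e⟩ := h
  simp only [Prod.mk.injEq] at e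
  rw [e.1, e.2]; exact ⟨c.2, d.2⟩

theorem shiftR_bound {x y : Fin (m + n)} (h : (x, y) ∈ shiftR (m := m) Q) :
    m ≤ (x : ℕ) ∧ m ≤ (y : ℕ) := by
  obtain ⟨⟨c, d⟩, _, e⟩ := h
  simp only [Prod.mk.injEq] at e
  rw [e.1, e.2]; simp

theorem shiftL_r1 (a : Fin n) (y : Fin (m + n)) :
    (Fin.natAdd m a, y) ∉ shiftL (n := n) P := fun h => by
  have := (shiftL_bound P h).1; simp at this

theorem shiftL_r2 (a : Fin n) (y : Fin (m + n)) :
    (y, Fin.natAdd m a) ∉ shiftL (n := n) P := fun h => by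
  have := (shiftL_bound P h).2; simp at this

theorem shiftR_l1 (a : Fin m) (y : Fin (m + n)) :
    (Fin.castAdd n a, y) ∉ shiftR (m := m) Q := fun h => by
  have := (shiftR_bound Q h).1; have := a.2; simp at *; omega

theorem shiftR_l2 (a : Fin m) (y : Fin (m + n)) :
    (y, Fin.castAdd n a) ∉ shiftR (m := m) Q := fun h => by
  have := (shiftR_bound Q h).2; have := a.2; simp at *; omega

theorem mem_lowHigh (x y : Fin (m + n)) :
    (x, y) ∈ lowHigh m n ↔ (x : ℕ) < m ∧ m ≤ (y : ℕ) := Iff.rfl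

theorem mem_highLow (x y : Fin (m + n)) :
    (x, y) ∈ highLow m n ↔ m ≤ (x : ℕ) ∧ (y : ℕ) < m := Iff.rfl

theorem forall_add (p : Fin (m + n) → Prop) :
    (∀ x, p x) ↔ (∀ a, p (Fin.castAdd n a)) ∧ ∀ b, p (Fin.natAdd m b) :=
  ⟨fun h => ⟨fun a => h _, fun a => h _⟩, fun h x => Fin.addCases h.1 h.2 x⟩

theorem under_total (hP : IsITotal P) (hQ : IsITotal Q) : IsITotal (underprod P Q) := by
  obtain ⟨⟨r, s, t⟩, u⟩ := hP
  obtain ⟨⟨r', s', t'⟩, u'⟩ := hQ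
  simp only [IsITotal, IsIPos, IsIRel, underprod, forall_add, Set.mem_union, shiftL_ll, shiftR_rr,
    shiftL_r1, shiftL_r2, shiftR_l1, shiftR_l2, mem_lowHigh, Fin.val_castAdd, Fin.val_natAdd,
    Fin.is_lt, Fin.castAdd_inj, Fin.natAdd_inj, not_le.2 (Fin.is_lt _), Nat.le_add_right,
    not_lt.2 (Nat.le_add_right _ _)]
  simp
  grind [IsIRel]

theorem over_total (hP : IsITotal P) (hQ : IsITotal Q) : IsITotal (overprod P Q) := by
  obtain ⟨⟨r, s, t⟩, u⟩ := hP
  obtain ⟨⟨r', s', t'⟩, u'⟩ := hQ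
  simp only [IsITotal, IsIPos, IsIRel, overprod, forall_add, Set.mem_union, shiftL_ll, shiftR_rr,
    shiftL_r1, shiftL_r2, shiftR_l1, shiftR_l2, mem_highLow, Fin.val_castAdd, Fin.val_natAdd,
    Fin.is_lt, Fin.castAdd_inj, Fin.natAdd_inj, not_le.2 (Fin.is_lt _), Nat.le_add_right,
    not_lt.2 (Nat.le_add_right _ _)]
  simp
  grind [IsIRel]

theorem core (T : Set (Fin (m + n) × Fin (m + n))) (hT : IsIRel T)
    (h₁ : WOle (underprod P Q) T) (h₂ : WOle T (overprod P Q)) (x y : Fin (m + n))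
    (hxy : (x, y) ∉ lowHigh m n) (hyx : (x, y) ∉ highLow m n) 
    (hr : IsIRel (underprod P Q)) :
    (x, y) ∈ T ↔ (x, y) ∈ shiftL (n := n) P ∪ shiftR (m := m) Q := by
  have e1 : (x, y) ∈ underprod P Q ↔ (x, y) ∈ shiftL (n := n) P ∪ shiftR (m := m) Q := by
    simp only [underprod, Set.mem_union _ _ (lowHigh m n), hxy, or_false]
  have e2 : (x, y) ∈ overprod P Q ↔ (x, y) ∈ shiftL (n := n) P ∪ shiftR (m := m) Q := by
    simp only [overprod, Set.mem_union _ _ (highLow m n), hyx, or_false]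
  rcases lt_trichotomy x y with h | h | h
  · exact ⟨fun k => e1.1 (h₁.1 ⟨k, h⟩).1, fun k => (h₂.1 ⟨e2.2 k, h⟩).1⟩
  · subst h
    exact ⟨fun _ => e1.1 (hr x), fun _ => hT x⟩
  · exact ⟨fun k => e2.1 (h₂.2 ⟨k, h⟩).1, fun k => (h₁.2 ⟨e1.2 k, h⟩).1⟩

end helpers

/-- the product of two total orders is a weak order interval of
total orders. -/
theorem totalOrder_product_interval (m n : ℕ)
    (P : Set (Fin m × Fin m)) (Q : Set (Fin n × Fin n))
    (hP : IsITotal P) (hQ : IsITotal Q) :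
    IsITotal (underprod P Q) ∧ IsITotal (overprod P Q) ∧
    {T | T ∈ shiftedShuffle P Q ∧ IsITotal T}
      = {T : Set (Fin (m + n) × Fin (m + n)) | IsITotal T ∧
          WOle (underprod P Q) T ∧ WOle T (overprod P Q)} := by
  refine ⟨under_total P Q hP hQ, over_total P Q hP hQ, ?_⟩
  ext T
  simp only [Set.mem_setOf_eq]
  constructor
  · rintro ⟨⟨I, D, hI, hD, rfl⟩, hT⟩
    refine ⟨hT, ⟨?_, ?_⟩, ⟨?_, ?_⟩⟩
    · rintro ⟨x, y⟩ ⟨((h | h) | h) | h, hlt⟩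
      · exact ⟨Or.inl (Or.inl h), hlt⟩
      · exact ⟨Or.inl (Or.inr h), hlt⟩
      · exact ⟨Or.inr (hI h), hlt⟩
      · have := hD h
        simp only [mem_highLow] at this
        simp only [Fin.lt_def] at hlt
        omega
    · rintro ⟨x, y⟩ ⟨(h | h) | h, hlt⟩
      · exact ⟨Or.inl (Or.inl (Or.inl h)), hlt⟩
      · exact ⟨Or.inl (Or.inl (Or.inr h)), hlt⟩
      · simp only [mem_lowHigh] at h
        simp only [Fin.lt_def] at hlt
        omega
    · rintro ⟨x, y⟩ ⟨(h | h) | h, hlt⟩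
      · exact ⟨Or.inl (Or.inl (Or.inl h)), hlt⟩
      · exact ⟨Or.inl (Or.inl (Or.inr h)), hlt⟩
      · simp only [mem_highLow] at h
        simp only [Fin.lt_def] at hlt
        omega
    · rintro ⟨x, y⟩ ⟨((h | h) | h) | h, hlt⟩
      · exact ⟨Or.inl (Or.inl h), hlt⟩
      · exact ⟨Or.inl (Or.inr h), hlt⟩
      · have := hI h
        simp only [mem_lowHigh] at this
        simp only [Fin.lt_def] at hlt
        omega
      · exact ⟨Or.inr (hD h), hlt⟩
  · rintro ⟨hT, h₁, h₂⟩
    refine ⟨⟨T ∩ lowHigh m n, T ∩ highLow m n, Set.inter_subset_right,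
      Set.inter_subset_right, ?_⟩, hT⟩
    have c := fun x y a b => core P Q T hT.1.1 h₁ h₂ x y a b (under_total P Q hP hQ).1.1
    ext ⟨x, y⟩
    by_cases a : (x, y) ∈ lowHigh m n
    · have b := a
      simp only [mem_lowHigh] at b
      have l : (x, y) ∉ shiftL (n := n) P := fun h => by
        have := shiftL_bound P h; omega
      have r : (x, y) ∉ shiftR (m := m) Q := fun h => by
        have := shiftR_bound Q h; omega
      have d : (x, y) ∉ highLow m n := fun h => by
        simp only [mem_highLow] at h; omega
      simp [a, l, r, d]
    · by_cases d : (x, y) ∈ highLow m n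
      · have b := d
        simp only [mem_highLow] at b
        have l : (x, y) ∉ shiftL (n := n) P := fun h => by
          have := shiftL_bound P h; omega
        have r : (x, y) ∉ shiftR (m := m) Q := fun h => by
          have := shiftR_bound Q h; omega
        simp [a, l, r, d]
      · rw [c x y a d]
        simp [a, d]

end IntegerRelations
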